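/- arXiv:1204.1025 — 6 statements merged into one kernel-verified Lean document; each statement's English description precedes it below -/
import Mathlib

section
/- Let U be a finite set, let k, n ≥ 1, and let A : Fin k × ZMod n → Set U be a family of subsets of U. Suppose there exists π : Fin k → ZMod n such that ⋃_{j ∈ Fin k} A(j, π(j)) = U (the YES case of the Max k-cover reduction). For each agent i ∈ ZMod n define the coverage valuation w_i on sets of items S ⊆ Fin k × ZMod n by w_i(S) = |⋃_{(j₁,j₂) ∈ S} A(j₁, j₂ + i)|, and define S_i = {(j, π(j) − i) : j ∈ Fin k}. Then the sets S_1, …, S_n are pairwise disjoint, and w_i(S_i) = |U| for every i ∈ ZMod n. Consequently the allocation assigning S_i to agent i achieves total welfare n·|U|. -/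
/-- YES-case analysis of the reduction from Max k-cover to welfare maximization with
coverage valuations: if some choice `π` of one set per group covers the universe `U`, then
the allocation giving agent `i` the items `S_i = {(j, π(j) − i) : j ∈ Fin k}` consists of
pairwise disjoint sets, fully satisfies every agent (`w_i(S_i) = |U|`), and hence achieves
total welfare `n·|U|`.  Here the coverage valuation of agent `i ∈ ZMod n` on a set `S` of
items is `w_i(S) = |⋃_{(j₁,j₂) ∈ S} A(j₁, j₂ + i)|`. -/
theorem yes_case_allocation {U : Type*} [Fintype U] (k n : ℕ) [NeZero n] (hk : 1 ≤ k)
    (A : Fin k × ZMod n → Set U) (π : Fin k → ZMod n)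
    (hyes : (⋃ j : Fin k, A (j, π j)) = Set.univ)
    (w : ZMod n → Finset (Fin k × ZMod n) → ℕ)
    (hw : ∀ (i : ZMod n) (S : Finset (Fin k × ZMod n)),
      w i S = Set.ncard (⋃ p ∈ S, A (p.1, p.2 + i)))
    (Salloc : ZMod n → Finset (Fin k × ZMod n))
    (hS : ∀ i : ZMod n, Salloc i = Finset.univ.image (fun j : Fin k => (j, π j - i))) :
    (∀ i i' : ZMod n, i ≠ i' → Disjoint (Salloc i) (Salloc i')) ∧
    (∀ i : ZMod n, w i (Salloc i) = Fintype.card U) ∧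
    (∑ i : ZMod n, w i (Salloc i)) = n * Fintype.card U := by
  have hfull : ∀ i : ZMod n, w i (Salloc i) = Fintype.card U := by
    intro i
    have hcover : (⋃ p ∈ Salloc i, A (p.1, p.2 + i)) = Set.univ := by
      rw [← hyes, hS, Finset.set_biUnion_finset_image]
      simp
    rw [hw, hcover, Set.ncard_univ, Nat.card_eq_fintype_card]
  refine ⟨fun i i' hne => ?_, hfull, ?_⟩
  · rw [hS, hS, Finset.disjoint_left]
    intro p hp hp'
    obtain ⟨j, -, rfl⟩ := Finset.mem_image.mp hp
    obtain ⟨j', -, h⟩ := Finset.mem_image.mp hp'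
    obtain ⟨rfl, h⟩ := Prod.mk.inj h
    exact hne (sub_right_injective h).symm
  · simp [hfull, ZMod.card]
end

section
/- Let k > 0 and u > 0 be reals, let ε' ∈ (0, 1], set c₀ = 1 + ln(1/ε'), and let μ be a real with 0 ≤ μ ≤ k·ln(1/ε'). Let X be an integrable random variable taking values in the nonnegative integers with E[X] = μ, and let ν : ℕ → ℝ satisfy (i) ν(ℓ) ≤ u for all ℓ, and (ii) ν(ℓ) ≤ (1 − e^{−ℓ/k} + ε')·u for all ℓ ≤ c₀·k. Then E[ν(X)] ≤ (1 − e^{−μ/k} + ε')·u. -/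
open MeasureTheory

/-- The concave function `x ↦ 1 - e^{-x}` lies below its tangent at `m`. -/
lemma one_sub_exp_neg_le_tangent (x m : ℝ) :
    1 - Real.exp (-x) ≤ 1 - Real.exp (-m) + Real.exp (-m) * (x - m) := by
  have hsplit : Real.exp (-x) = Real.exp (-m) * Real.exp (-(x - m)) := by
    rw [← Real.exp_add]
    ring_nf
  nlinarith [Real.add_one_le_exp (-(x - m)), Real.exp_pos (-m)]

/-- An expectation is at most the value at the mean of any affine majorant. -/
lemma integral_comp_le_of_le_affine {Ω : Type*} [MeasurableSpace Ω] {P : Measure Ω}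
    [IsProbabilityMeasure P] {X : Ω → ℕ} {ν : ℕ → ℝ} {a b : ℝ}
    (hX : Integrable (fun ω => (X ω : ℝ)) P) (hν : Integrable (fun ω => ν (X ω)) P)
    (h : ∀ ℓ : ℕ, ν ℓ ≤ a + b * ℓ) :
    ∫ ω, ν (X ω) ∂P ≤ a + b * ∫ ω, (X ω : ℝ) ∂P := by
  calc ∫ ω, ν (X ω) ∂P ≤ ∫ ω, (a + b * (X ω : ℝ)) ∂P :=
        integral_mono hν ((integrable_const a).add (hX.const_mul b)) fun ω => h (X ω)
    _ = a + b * ∫ ω, (X ω : ℝ) ∂P := by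
        rw [integral_add (integrable_const a) (hX.const_mul b), integral_const_mul]
        simp

/-- Core of Claim 2.3: let `0 < k`, `0 < u`, `ε' ∈ (0,1]`, `c₀ = 1 + ln(1/ε')`, and
`0 ≤ μ ≤ k·ln(1/ε')`.  If `X` is an integrable nonnegative-integer-valued random variable
with `E[X] = μ`, and `ν : ℕ → ℝ` satisfies `ν(ℓ) ≤ u` for all `ℓ` and
`ν(ℓ) ≤ (1 − e^{−ℓ/k} + ε')·u` for all `ℓ ≤ c₀·k`, then
`E[ν(X)] ≤ (1 − e^{−μ/k} + ε')·u`. -/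
theorem expected_value_bound {Ω : Type*} [MeasureSpace Ω]
    [IsProbabilityMeasure (volume : Measure Ω)]
    (k u ε' c₀ μ : ℝ) (hk : 0 < k) (hu : 0 < u) (hε : 0 < ε') (hε1 : ε' ≤ 1)
    (hc₀ : c₀ = 1 + Real.log (1 / ε')) (hμ0 : 0 ≤ μ) (hμk : μ ≤ k * Real.log (1 / ε'))
    (X : Ω → ℕ) (hXint : Integrable (fun ω => (X ω : ℝ)))
    (hEX : (∫ ω, (X ω : ℝ)) = μ)
    (ν : ℕ → ℝ)
    (hνu : ∀ ℓ : ℕ, ν ℓ ≤ u)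
    (hνexp : ∀ ℓ : ℕ, (ℓ : ℝ) ≤ c₀ * k → ν ℓ ≤ (1 - Real.exp (-(ℓ : ℝ) / k) + ε') * u)
    (hνint : Integrable (fun ω => ν (X ω))) :
    (∫ ω, ν (X ω)) ≤ (1 - Real.exp (-μ / k) + ε') * u := by
  have hm : μ / k ≤ Real.log (1 / ε') := by
    rw [div_le_iff₀ hk]
    linarith
  have hslope := Real.exp_pos (-(μ / k))
  have hmajorant : ∀ ℓ : ℕ, ν ℓ ≤
      (1 - Real.exp (-(μ / k)) + ε' - Real.exp (-(μ / k)) * (μ / k)) * u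
        + Real.exp (-(μ / k)) * u / k * ℓ := by
    intro ℓ
    have htangent : (1 - Real.exp (-(μ / k)) + ε' - Real.exp (-(μ / k)) * (μ / k)) * u
        + Real.exp (-(μ / k)) * u / k * ℓ
        = (1 - Real.exp (-(μ / k)) + Real.exp (-(μ / k)) * (ℓ / k - μ / k) + ε') * u := by
      ring
    rw [htangent]
    rcases le_or_gt (ℓ : ℝ) (c₀ * k) with hℓ | hℓ
    · refine (hνexp ℓ hℓ).trans (mul_le_mul_of_nonneg_right ?_ hu.le)
      rw [neg_div]
      linarith [one_sub_exp_neg_le_tangent (ℓ / k) (μ / k)]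
    · refine (hνu ℓ).trans (le_mul_of_one_le_left hu.le ?_)
      have hfar : c₀ < ℓ / k := (lt_div_iff₀ hk).2 hℓ
      nlinarith
  have hbound := integral_comp_le_of_le_affine hXint hνint hmajorant
  rw [hEX] at hbound
  refine hbound.trans_eq ?_
  rw [neg_div]
  ring
end

section
/- Let f : (Fin m → ℕ) → ℝ have the property of diminishing returns: for all x ≤ y coordinate-wise and every i ∈ Fin m, f(x + e_i) − f(x) ≥ f(y + e_i) − f(y), where e_i is the i-th unit basis vector. Then for all x, s : Fin m → ℕ, f(x + s) − f(x) ≤ ∑_{j ∈ Fin m} s(j) · (f(x + e_j) − f(x)). -/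
/-- If `f` on multisets (encoded as `Fin m → ℕ`) has the diminishing-returns property, then
the marginal value of a multiset is at most the sum of the marginal values of its items,
counted with multiplicity. -/
theorem marginal_le_sum_of_diminishing_returns {m : ℕ} (f : (Fin m → ℕ) → ℝ)
    (hdr : ∀ x y : Fin m → ℕ, x ≤ y → ∀ i : Fin m,
      f (y + Pi.single i 1) - f y ≤ f (x + Pi.single i 1) - f x)
    (x s : Fin m → ℕ) :
    f (x + s) - f x ≤ ∑ j : Fin m, (s j : ℝ) * (f (x + Pi.single j 1) - f x) := by
  induction hn : ∑ j, s j generalizing s with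
  | zero =>
    obtain rfl : s = 0 := by
      ext j
      exact Finset.sum_eq_zero_iff.mp hn j (Finset.mem_univ j)
    simp
  | succ n ih =>
    obtain ⟨i, -, hi⟩ := Finset.exists_ne_zero_of_sum_ne_zero (hn.trans_ne n.succ_ne_zero)
    obtain ⟨t, rfl⟩ : ∃ t, s = t + Pi.single i 1 := by
      refine ⟨s - Pi.single i 1, (tsub_add_cancel_of_le fun j => ?_).symm⟩
      rcases eq_or_ne j i with rfl | hj
      · simpa using Nat.one_le_iff_ne_zero.mpr hi
      · simp [hj]
    have ht : ∑ j, t j = n := by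
      simpa [Finset.sum_add_distrib] using hn
    have hsum : ∑ j, ((t + Pi.single i 1 : Fin m → ℕ) j : ℝ) * (f (x + Pi.single j 1) - f x) =
        ∑ j, (t j : ℝ) * (f (x + Pi.single j 1) - f x) + (f (x + Pi.single i 1) - f x) := by
      simp [add_mul, Finset.sum_add_distrib, Pi.single_apply]
    rw [hsum, ← add_assoc]
    linarith [ih t ht, hdr x (x + t) le_self_add i]
end

section
/- Fix n agents with valuations w_i : (Fin q → ℕ) → ℝ on multisets of q item types, a probability vector p : Fin q → ℝ (p_j ≥ 0, ∑_j p_j = 1), and a number of steps m ≥ 1. Define LP as the supremum of ∑_{i,S} x_{i,S} · w_i(S) over all x : Fin n × 𝒮 → ℝ≥0, where 𝒮 is the (finite) set of multisets S over Fin q of total size at most m, subject to: ∑_{i,S} x_{i,S} · c_j(S) ≤ p_j · m for every item type j (where c_j(S) is the number of copies of j in S), and ∑_{S} x_{i,S} = 1 for every agent i. Let the random multiset M be the count vector of m i.i.d. draws from p, and let (S_1, …, S_n) be any random allocation (measurable with respect to the draws, and possibly additional randomness) satisfying ∑_{i} S_i ≤ M coordinate-wise. Then E[∑_{i=1}^n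 w_i(S_i)] ≤ LP. In particular the expected offline optimum E[OPT(M)] is at most LP. -/
open Finset in
/-- The total mass of the product distribution of `m` i.i.d. draws is one. -/
lemma sum_prod_draws_eq_one {ι κ : Type*} [Fintype ι] [DecidableEq ι] [Fintype κ] (p : κ → ℝ)
    (hp1 : ∑ j, p j = 1) : ∑ σ : ι → κ, ∏ t, p (σ t) = 1 := by
  rw [← Fintype.prod_sum (fun (_ : ι) k => p k)]
  simp [hp1]

open Finset in
/-- The expected number of copies of `j` among i.i.d. draws from `p`. -/
lemma sum_prod_draws_mul_count {ι κ : Type*} [Fintype ι] [DecidableEq ι] [Fintype κ]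
    [DecidableEq κ] (p : κ → ℝ) (hp1 : ∑ j, p j = 1) (j : κ) :
    ∑ σ : ι → κ, (∏ t, p (σ t)) * (#{t | σ t = j} : ℝ) = p j * Fintype.card ι := by
  have single_draw (t : ι) :
      ∑ σ : ι → κ, (∏ s, p (σ s)) * (if σ t = j then 1 else 0) = p j := by
    have factor (σ : ι → κ) : (∏ s, p (σ s)) * (if σ t = j then 1 else 0) =
        ∏ s, p (σ s) * (if s = t then (if σ s = j then 1 else 0) else 1) := by
      rw [prod_mul_distrib, Fintype.prod_ite_eq' t (fun s => if σ s = j then (1 : ℝ) else 0)]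
    simp_rw [factor]
    rw [← Fintype.prod_sum
      (fun s k => p k * (if s = t then (if k = j then 1 else 0) else 1)),
      Fintype.prod_eq_single t]
    · simp
    · intro s hs
      simp [hs, hp1]
  simp_rw [card_filter, Nat.cast_sum, Nat.cast_ite, Nat.cast_one, Nat.cast_zero, mul_sum]
  rw [sum_comm]
  simp_rw [single_draw]
  simp [mul_comm]

/-- The objective values of the feasible points of the configuration LP are bounded above. -/
lemma bddAbove_configLP_values {ι κ : Type*} [Fintype ι] (w : ι → (κ → ℕ) → ℝ)
    (𝒮 : Finset (κ → ℕ)) (b : κ → ℝ) :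
    BddAbove {v : ℝ | ∃ x : ι → (κ → ℕ) → ℝ,
      (∀ i S, 0 ≤ x i S) ∧
      (∀ j, ∑ i, ∑ S ∈ 𝒮, x i S * (S j : ℝ) ≤ b j) ∧
      (∀ i, ∑ S ∈ 𝒮, x i S = 1) ∧
      v = ∑ i, ∑ S ∈ 𝒮, x i S * w i S} := by
  refine ⟨∑ i, ∑ S ∈ 𝒮, |w i S|, ?_⟩
  rintro _ ⟨x, hx, -, hx1, rfl⟩
  gcongr with i _ S hS
  have hle : x i S ≤ 1 := hx1 i ▸ Finset.single_le_sum (fun T _ => hx i T) hS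
  calc x i S * w i S ≤ x i S * |w i S| := by gcongr; exacts [hx i S, le_abs_self _]
    _ ≤ 1 * |w i S| := by gcongr
    _ = |w i S| := one_mul _

/-- The distribution of a random allocation whose expected use of each item type `j` is at most
`b j` is feasible for the configuration LP, with objective value the expected welfare. -/
lemma expected_welfare_mem_configLP_values {Ω ι κ : Type*} [Fintype Ω] [Fintype ι]
    (w : ι → (κ → ℕ) → ℝ) (𝒮 : Finset (κ → ℕ)) (b : κ → ℝ) (μ : Ω → ℝ) (hμ : ∀ ω, 0 ≤ μ ω)
    (hμ1 : ∑ ω, μ ω = 1) (A : Ω → ι → κ → ℕ) (hA : ∀ ω i, A ω i ∈ 𝒮)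
    (hb : ∀ j, ∑ ω, μ ω * ((∑ i, A ω i j : ℕ) : ℝ) ≤ b j) :
    ∑ ω, μ ω * ∑ i, w i (A ω i) ∈ {v : ℝ | ∃ x : ι → (κ → ℕ) → ℝ,
      (∀ i S, 0 ≤ x i S) ∧
      (∀ j, ∑ i, ∑ S ∈ 𝒮, x i S * (S j : ℝ) ≤ b j) ∧
      (∀ i, ∑ S ∈ 𝒮, x i S = 1) ∧
      v = ∑ i, ∑ S ∈ 𝒮, x i S * w i S} := by
  classical
  have expectation (i : ι) (f : (κ → ℕ) → ℝ) :
      ∑ S ∈ 𝒮, (∑ ω, if A ω i = S then μ ω else 0) * f S = ∑ ω, μ ω * f (A ω i) := by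
    simp_rw [Finset.sum_mul]
    rw [Finset.sum_comm]
    simp [hA]
  have expectation_sum (f : ι → (κ → ℕ) → ℝ) :
      ∑ i, ∑ S ∈ 𝒮, (∑ ω, if A ω i = S then μ ω else 0) * f i S =
        ∑ ω, μ ω * ∑ i, f i (A ω i) := by
    simp_rw [expectation, Finset.mul_sum]
    exact Finset.sum_comm
  refine ⟨fun i S => ∑ ω, if A ω i = S then μ ω else 0, fun i S => ?_, fun j => ?_,
    fun i => ?_, (expectation_sum w).symm⟩
  · exact Finset.sum_nonneg fun ω _ => by split_ifs <;> simp [hμ]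
  · rw [expectation_sum fun _ S => (S j : ℝ)]
    simpa using hb j
  · simpa [hμ1] using expectation i fun _ => 1

/-- The optimal welfare over allocations of a finite multiset of items is attained. -/
lemma exists_optimal_allocation {ι κ : Type*} [Fintype ι] [Fintype κ]
    (w : ι → (κ → ℕ) → ℝ) (c : κ → ℕ) :
    ∃ S : ι → κ → ℕ, (∀ j, ∑ i, S i j ≤ c j) ∧
      sSup {v : ℝ | ∃ S : ι → κ → ℕ, (∀ j, ∑ i, S i j ≤ c j) ∧ v = ∑ i, w i (S i)} =
        ∑ i, w i (S i) := by
  classical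
  have hfin : {S : ι → κ → ℕ | ∀ j, ∑ i, S i j ≤ c j}.Finite :=
    (Set.finite_Iic (fun _ => c : ι → κ → ℕ)).subset fun S hS i j =>
      (Finset.single_le_sum (f := fun i => S i j) (fun _ _ => Nat.zero_le _)
        (Finset.mem_univ i)).trans (hS j)
  refine Set.Nonempty.csSup_mem
    (s := {v : ℝ | ∃ S : ι → κ → ℕ, (∀ j, ∑ i, S i j ≤ c j) ∧ v = ∑ i, w i (S i)})
    ⟨_, 0, by simp, rfl⟩ ?_
  refine (hfin.image fun S => ∑ i, w i (S i)).subset ?_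
  rintro _ ⟨S, hS, rfl⟩
  exact ⟨S, hS, rfl⟩

/-- Lemma 4.4 (LP bound for the i.i.d. stochastic model).  Fix `n` agents with valuations
`w i` on multisets over `Fin q` (encoded as count vectors `Fin q → ℕ`), a probability
vector `p`, and `m ≥ 1` steps.  Let `𝒮` be the finite set of multisets of total size at
most `m`, and let `LP` be the supremum of `∑_{i,S} x_{i,S}·w_i(S)` over all `x ≥ 0` with
`∑_{i,S} x_{i,S}·c_j(S) ≤ p_j·m` for every item type `j` and `∑_S x_{i,S} = 1` for every
agent `i`.  Let the input be `m` i.i.d. draws `σ` from `p` (together with independent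
auxiliary randomness `r` with distribution `ρ`), and let `alloc σ r` be any allocation
with `∑_i alloc σ r i ≤ M(σ)` coordinate-wise, where `M(σ)` is the count vector of `σ`.
Then the expected welfare of the allocation is at most `LP`; in particular the expected
offline optimum `E[OPT(M)]` is at most `LP`. -/
theorem expected_welfare_le_LP (n q m : ℕ) (hm : 1 ≤ m)
    (w : Fin n → (Fin q → ℕ) → ℝ)
    (p : Fin q → ℝ) (hp : ∀ j, 0 ≤ p j) (hp1 : ∑ j, p j = 1)
    (𝒮 : Finset (Fin q → ℕ))
    (h𝒮 : 𝒮 = (Finset.Iic (fun _ => m : Fin q → ℕ)).filter (fun S => ∑ j, S j ≤ m))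
    (LP : ℝ)
    (hLP : LP = sSup {v : ℝ | ∃ x : Fin n → (Fin q → ℕ) → ℝ,
      (∀ (i : Fin n) (S : Fin q → ℕ), 0 ≤ x i S) ∧
      (∀ j : Fin q, ∑ i : Fin n, ∑ S ∈ 𝒮, x i S * (S j : ℝ) ≤ p j * m) ∧
      (∀ i : Fin n, ∑ S ∈ 𝒮, x i S = 1) ∧
      v = ∑ i : Fin n, ∑ S ∈ 𝒮, x i S * w i S})
    -- auxiliary randomness
    (R : Type*) [Fintype R] (ρ : R → ℝ) (hρ : ∀ r, 0 ≤ ρ r) (hρ1 : ∑ r, ρ r = 1)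
    -- the random allocation
    (alloc : (Fin m → Fin q) → R → Fin n → (Fin q → ℕ))
    (halloc : ∀ (σ : Fin m → Fin q) (r : R) (j : Fin q),
      ∑ i : Fin n, alloc σ r i j ≤ (Finset.univ.filter fun t => σ t = j).card)
    -- the offline optimum
    (OPT : (Fin m → Fin q) → ℝ)
    (hOPT : ∀ σ : Fin m → Fin q, OPT σ = sSup {v : ℝ | ∃ S : Fin n → Fin q → ℕ,
      (∀ j : Fin q, ∑ i : Fin n, S i j ≤ (Finset.univ.filter fun t => σ t = j).card) ∧
      v = ∑ i : Fin n, w i (S i)}) :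
    (∑ σ : Fin m → Fin q, ∑ r : R,
        (∏ t, p (σ t)) * ρ r * (∑ i : Fin n, w i (alloc σ r i))) ≤ LP ∧
    (∑ σ : Fin m → Fin q, (∏ t, p (σ t)) * OPT σ) ≤ LP := by
  subst h𝒮 hLP
  have mass : ∑ σ : Fin m → Fin q, ∏ t, p (σ t) = 1 := sum_prod_draws_eq_one p hp1
  have prob_nonneg (σ : Fin m → Fin q) : 0 ≤ ∏ t, p (σ t) :=
    Finset.prod_nonneg fun t _ => hp (σ t)
  have bundle_mem (σ : Fin m → Fin q) (S : Fin n → Fin q → ℕ)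
      (hS : ∀ j, ∑ i, S i j ≤ (Finset.univ.filter fun t => σ t = j).card) (i : Fin n) :
      S i ∈ (Finset.Iic (fun _ => m : Fin q → ℕ)).filter (fun S => ∑ j, S j ≤ m) := by
    have total : ∑ j, S i j ≤ m := by
      calc ∑ j, S i j ≤ ∑ j, (Finset.univ.filter fun t => σ t = j).card :=
            Finset.sum_le_sum fun j _ => (Finset.single_le_sum (f := fun i => S i j)
              (fun _ _ => Nat.zero_le _) (Finset.mem_univ i)).trans (hS j)
        _ = m := by
            rw [← Finset.card_eq_sum_card_fiberwise fun _ _ => Finset.mem_coe.2 (Finset.mem_univ _)]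
            simp
    rw [Finset.mem_filter, Finset.mem_Iic]
    exact ⟨fun j => (Finset.single_le_sum (fun _ _ => Nat.zero_le _)
      (Finset.mem_univ j)).trans total, total⟩
  have welfare_le (A : (Fin m → Fin q) → R → Fin n → Fin q → ℕ)
      (hA : ∀ σ r j, ∑ i, A σ r i j ≤ (Finset.univ.filter fun t => σ t = j).card) :=
    le_csSup (bddAbove_configLP_values w _ fun j => p j * m)
      (expected_welfare_mem_configLP_values w
        ((Finset.Iic (fun _ => m : Fin q → ℕ)).filter (fun S => ∑ j, S j ≤ m))
        (fun j => p j * m) (fun ω : (Fin m → Fin q) × R => (∏ t, p (ω.1 t)) * ρ ω.2)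
        (fun ω => mul_nonneg (prob_nonneg ω.1) (hρ ω.2))
        (by simp [Fintype.sum_prod_type, ← Finset.mul_sum, hρ1, mass])
        (fun ω => A ω.1 ω.2) (fun ω => bundle_mem ω.1 _ (hA ω.1 ω.2))
        (fun j => by
          calc _ ≤ ∑ ω : (Fin m → Fin q) × R, (∏ t, p (ω.1 t)) * ρ ω.2 *
                ((Finset.univ.filter fun t => ω.1 t = j).card : ℝ) := by
                gcongr with ω _
                · exact mul_nonneg (prob_nonneg ω.1) (hρ ω.2)
                · exact hA ω.1 ω.2 j
            _ = ∑ σ : Fin m → Fin q, (∏ t, p (σ t)) *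
                ((Finset.univ.filter fun t => σ t = j).card : ℝ) := by
                simp [Fintype.sum_prod_type, ← Finset.mul_sum, ← Finset.sum_mul, hρ1]
            _ ≤ p j * m := by
                rw [sum_prod_draws_mul_count p hp1 j, Fintype.card_fin]))
  refine ⟨?_, ?_⟩
  · simpa only [Fintype.sum_prod_type] using welfare_le alloc halloc
  · choose S hS hSopt using fun σ : Fin m → Fin q =>
      exists_optimal_allocation w fun j => (Finset.univ.filter fun t => σ t = j).card
    simp_rw [hOPT, hSopt]
    have hR : ∑ σ : Fin m → Fin q, (∏ t, p (σ t)) * ∑ i, w i (S σ i) =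
        ∑ σ : Fin m → Fin q, ∑ r, (∏ t, p (σ t)) * ρ r * ∑ i, w i (S σ i) := by
      simp_rw [← Finset.sum_mul, ← Finset.mul_sum, hρ1, mul_one]
    rw [hR]
    simpa only [Fintype.sum_prod_type] using welfare_le (fun σ _ => S σ) fun σ _ => hS σ
end

section
/- Fix n agents with valuations w_i : (Fin q → ℕ) → ℝ that are monotone (w_i(x) ≤ w_i(y) whenever x ≤ y coordinate-wise) and satisfy diminishing returns (for x ≤ y and every unit vector e_j, w_i(x + e_j) − w_i(x) ≥ w_i(y + e_j) − w_i(y)). Fix a probability vector p : Fin q → ℝ and m ≥ 1, and let LP be the optimum of the linear program with variables x_{i,S} ≥ 0 over agents i and multisets S over Fin q of size at most m, maximizing ∑_{i,S} x_{i,S} w_i(S) subject to ∑_{i,S} x_{i,S}·c_j(S) ≤ p_j·m for each item type j and ∑_S x_{i,S} = 1 for each agent i. Then for any partial allocation (T_1, …, T_n) of multisets to the agents, the expected greedy gain from one random item satisfies ∑_{j ∈ Fin q} p_j · max_{i} (w_i(T_i + e_j) − w_i(T_i)) ≥ (1/m) · (LP − ∑_{i=1}^n w_i(T_i)). -/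
/-- A function with diminishing returns grows from `x` to `x + S` by at most the sum of its
marginal gains at `x`, counted with multiplicity. -/
theorem le_add_sum_marginal_of_diminishing {ι : Type*} [Fintype ι] [DecidableEq ι]
    (f : (ι → ℕ) → ℝ)
    (hf : ∀ x y : ι → ℕ, x ≤ y → ∀ j : ι,
      f (y + Pi.single j 1) - f y ≤ f (x + Pi.single j 1) - f x)
    (x S : ι → ℕ) :
    f (x + S) ≤ f x + ∑ j, (S j : ℝ) * (f (x + Pi.single j 1) - f x) := by
  induction hk : ∑ j, S j generalizing S with
  | zero =>
    obtain rfl : S = 0 := by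
      ext j
      simpa using (Finset.sum_eq_zero_iff.mp hk) j (Finset.mem_univ j)
    simp
  | succ k ih =>
    obtain ⟨j, -, hj⟩ := Finset.exists_ne_zero_of_sum_ne_zero (by omega : ∑ j, S j ≠ 0)
    obtain ⟨R, rfl⟩ : ∃ R : ι → ℕ, S = R + Pi.single j 1 := by
      refine ⟨S - Pi.single j 1, (tsub_add_cancel_of_le fun l => ?_).symm⟩
      obtain rfl | hl := eq_or_ne l j
      · simpa using Nat.one_le_iff_ne_zero.mpr hj
      · simp [hl]
    have hR := ih R (by simpa [Finset.sum_add_distrib] using hk)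
    have hstep := hf x (x + R) le_self_add j
    have hsum : ∑ l, ((R + Pi.single j 1 : ι → ℕ) l : ℝ) * (f (x + Pi.single l 1) - f x) =
        ∑ l, (R l : ℝ) * (f (x + Pi.single l 1) - f x) + (f (x + Pi.single j 1) - f x) := by
      simp [add_mul, Finset.sum_add_distrib, Pi.single_apply]
    rw [hsum, ← add_assoc]
    linarith


/-- Lemma 4.5 (expected greedy gain).  Fix `n ≥ 1` agents with monotone valuations
`w i` on multisets over `Fin q` satisfying diminishing returns, a probability vector `p`,
`m ≥ 1`, and let `LP` be the optimum of the linear program of Lemma 4.4.  Then for any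
partial allocation `(T_1, …, T_n)`, the expected gain of the greedy rule on one random
item drawn from `p`, namely `∑_j p_j · max_i (w_i(T_i + e_j) − w_i(T_i))`, is at least
`(1/m)·(LP − ∑_i w_i(T_i))`. -/
theorem greedy_expected_gain (n q m : ℕ) [NeZero n] (hm : 1 ≤ m)
    (w : Fin n → (Fin q → ℕ) → ℝ)
    (hmono : ∀ (i : Fin n) (x y : Fin q → ℕ), x ≤ y → w i x ≤ w i y)
    (hdr : ∀ (i : Fin n) (x y : Fin q → ℕ), x ≤ y → ∀ j : Fin q,
      w i (y + Pi.single j 1) - w i y ≤ w i (x + Pi.single j 1) - w i x)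
    (p : Fin q → ℝ) (hp : ∀ j, 0 ≤ p j) (hp1 : ∑ j, p j = 1)
    (𝒮 : Finset (Fin q → ℕ))
    (h𝒮 : 𝒮 = (Finset.Iic (fun _ => m : Fin q → ℕ)).filter (fun S => ∑ j, S j ≤ m))
    (LP : ℝ)
    (hLP : LP = sSup {v : ℝ | ∃ x : Fin n → (Fin q → ℕ) → ℝ,
      (∀ (i : Fin n) (S : Fin q → ℕ), 0 ≤ x i S) ∧
      (∀ j : Fin q, ∑ i : Fin n, ∑ S ∈ 𝒮, x i S * (S j : ℝ) ≤ p j * m) ∧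
      (∀ i : Fin n, ∑ S ∈ 𝒮, x i S = 1) ∧
      v = ∑ i : Fin n, ∑ S ∈ 𝒮, x i S * w i S})
    (T : Fin n → Fin q → ℕ) :
    (1 / (m : ℝ)) * (LP - ∑ i : Fin n, w i (T i)) ≤
      ∑ j : Fin q, p j * (Finset.univ.sup' Finset.univ_nonempty
        fun i : Fin n => w i (T i + Pi.single j 1) - w i (T i)) := by
  set G : Fin q → ℝ := fun j => Finset.univ.sup' Finset.univ_nonempty
    fun i : Fin n => w i (T i + Pi.single j 1) - w i (T i)
  have hG_ge (i : Fin n) (j : Fin q) : w i (T i + Pi.single j 1) - w i (T i) ≤ G j :=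
    Finset.le_sup' (fun i : Fin n => w i (T i + Pi.single j 1) - w i (T i)) (Finset.mem_univ i)
  have hG_nonneg (j : Fin q) : 0 ≤ G j :=
    (sub_nonneg.mpr (hmono 0 _ _ le_self_add)).trans (hG_ge 0 j)
  have hw (i : Fin n) (S : Fin q → ℕ) : w i S ≤ w i (T i) + ∑ j, (S j : ℝ) * G j :=
    calc w i S ≤ w i (T i + S) := hmono i _ _ le_add_self
      _ ≤ _ := le_add_sum_marginal_of_diminishing (w i) (hdr i) (T i) S
      _ ≤ _ := by gcongr with j; exact hG_ge i j
  have hLP_le : LP ≤ ∑ i, w i (T i) + m * ∑ j, p j * G j := by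
    rw [hLP]
    refine csSup_le ?_ ?_
    · refine ⟨_, fun _ S => if S = 0 then 1 else 0, fun _ S => by positivity, fun j => ?_,
        fun _ => ?_, rfl⟩
      · simpa [ite_mul] using mul_nonneg (hp j) m.cast_nonneg
      · simp [h𝒮]
    · rintro _ ⟨x, hx, hcap, hone, rfl⟩
      calc ∑ i, ∑ S ∈ 𝒮, x i S * w i S
          ≤ ∑ i, ∑ S ∈ 𝒮, x i S * (w i (T i) + ∑ j, (S j : ℝ) * G j) := by
            gcongr with i _ S
            · exact hx i S
            · exact hw i S
        _ = ∑ i, w i (T i) + ∑ j, (∑ i, ∑ S ∈ 𝒮, x i S * (S j : ℝ)) * G j := by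
            simp only [mul_add, Finset.sum_add_distrib, ← Finset.sum_mul, hone, one_mul]
            congr 1
            simp only [Finset.sum_mul, Finset.mul_sum, ← mul_assoc]
            rw [Finset.sum_comm (s := Finset.univ (α := Fin q))]
            exact Finset.sum_congr rfl fun i _ => Finset.sum_comm
        _ ≤ ∑ i, w i (T i) + ∑ j, (p j * m) * G j := by
            gcongr with j
            · exact hG_nonneg j
            · exact hcap j
        _ = ∑ i, w i (T i) + m * ∑ j, p j * G j := by
            rw [Finset.mul_sum]
            congr 1
            exact Finset.sum_congr rfl fun j _ => by ring
  rw [one_div, inv_mul_le_iff₀ (by exact_mod_cast hm)]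
  linarith
end

section
/- Fix n agents with valuations w_i : (Fin q → ℕ) → ℝ on multisets of q item types that are nonnegative, monotone (w_i(x) ≤ w_i(y) whenever x ≤ y coordinate-wise), and satisfy diminishing returns (for x ≤ y and every unit vector e_j, w_i(x + e_j) − w_i(x) ≥ w_i(y + e_j) − w_i(y)). Let p be a probability distribution on Fin q and m ≥ 1. Define the greedy allocation G(σ) for a sequence σ ∈ (Fin q)^m as follows: process σ₁, …, σ_m in order, and assign each item σ_t to the agent of smallest index maximizing the marginal gain w_i(T_i + e_{σ_t}) − w_i(T_i), where (T_1,…,T_n) is the current partial allocation. For a sequence σ, let OPT(σ) be the maximum of ∑_i w_i(S_i) over all decompositions of the count vector of σ as ∑_i S_i. Then, when σ is drawn as m i.i.d. samples from p, E[∑_{i=1}^n w_i(G(σ)_i)] ≥ (1 − 1/e) · E[OPT(σ)]. -/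
/-- One step of the greedy algorithm: given the current partial allocation `T` and an
arriving item of type `j`, return the agent of smallest index maximizing the marginal gain
`w i (T i + e_j) − w i (T i)`. -/
noncomputable def greedyStep {n q : ℕ} [NeZero n] (w : Fin n → (Fin q → ℕ) → ℝ)
    (T : Fin n → Fin q → ℕ) (j : Fin q) : Fin n :=
  let s : Finset (Fin n) := Finset.univ.filter fun i : Fin n =>
    ∀ i' : Fin n, w i' (T i' + Pi.single j 1) - w i' (T i') ≤
      w i (T i + Pi.single j 1) - w i (T i)
  if h : s.Nonempty then s.min' h else ⟨0, Nat.pos_of_ne_zero (NeZero.ne n)⟩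

/-- The greedy allocation obtained by processing a list of items in order, assigning each
item to the agent chosen by `greedyStep`, starting from the empty allocation. -/
noncomputable def greedyAlloc {n q : ℕ} [NeZero n] (w : Fin n → (Fin q → ℕ) → ℝ)
    (l : List (Fin q)) : Fin n → Fin q → ℕ :=
  l.foldl (fun T j =>
      Function.update T (greedyStep w T j) (T (greedyStep w T j) + Pi.single j 1))
    (fun _ _ => 0)

open Finset

/-- The allocation obtained from `T` by giving an item of type `j` to the greedy agent. -/
noncomputable def greedyUpdate {n q : ℕ} [NeZero n] (w : Fin n → (Fin q → ℕ) → ℝ)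
    (T : Fin n → Fin q → ℕ) (j : Fin q) : Fin n → Fin q → ℕ :=
  Function.update T (greedyStep w T j) (T (greedyStep w T j) + Pi.single j 1)

theorem marginal_le_marginal_greedyStep {n q : ℕ} [NeZero n] (w : Fin n → (Fin q → ℕ) → ℝ)
    (T : Fin n → Fin q → ℕ) (j : Fin q) (i : Fin n) :
    w i (T i + Pi.single j 1) - w i (T i) ≤
      w (greedyStep w T j) (T (greedyStep w T j) + Pi.single j 1) -
        w (greedyStep w T j) (T (greedyStep w T j)) := by
  set s : Finset (Fin n) := Finset.univ.filter fun i : Fin n =>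
    ∀ i' : Fin n, w i' (T i' + Pi.single j 1) - w i' (T i') ≤
      w i (T i + Pi.single j 1) - w i (T i) with hs
  have hne : s.Nonempty := by
    obtain ⟨k, hk⟩ := Finite.exists_max
      fun i : Fin n => w i (T i + Pi.single j 1) - w i (T i)
    exact ⟨k, by simpa [hs] using hk⟩
  have hstep : greedyStep w T j = s.min' hne := by
    simp only [greedyStep]
    exact dif_pos hne
  have hmem : greedyStep w T j ∈ s := hstep ▸ s.min'_mem hne
  exact (mem_filter.mp hmem).2 i

/-- The welfare increase of a greedy step is the marginal gain of the chosen agent. -/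
theorem welfare_greedyUpdate_sub {n q : ℕ} [NeZero n] (w : Fin n → (Fin q → ℕ) → ℝ)
    (T : Fin n → Fin q → ℕ) (j : Fin q) :
    ∑ i, w i (greedyUpdate w T j i) - ∑ i, w i (T i) =
      w (greedyStep w T j) (T (greedyStep w T j) + Pi.single j 1) -
        w (greedyStep w T j) (T (greedyStep w T j)) := by
  rw [← sum_sub_distrib, Finset.sum_eq_single (greedyStep w T j)]
  · simp [greedyUpdate]
  · intro i _ hi
    simp [greedyUpdate, Function.update_of_ne hi]
  · simp

/-- Under diminishing returns, the gain of a multiset is at most the sum of the marginal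
gains of its elements. -/
theorem le_add_sum_marginal {q : ℕ} (f : (Fin q → ℕ) → ℝ)
    (hdr : ∀ x y : Fin q → ℕ, x ≤ y → ∀ j : Fin q,
      f (y + Pi.single j 1) - f y ≤ f (x + Pi.single j 1) - f x)
    (x s : Fin q → ℕ) :
    f (x + s) ≤ f x + ∑ j, (s j : ℝ) * (f (x + Pi.single j 1) - f x) := by
  induction hk : ∑ j, s j generalizing s with
  | zero =>
    have hs : s = 0 := by
      ext j
      exact (Finset.sum_eq_zero_iff.mp hk) j (mem_univ j)
    simp [hs]
  | succ k ih =>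
    obtain ⟨j, -, hj⟩ : ∃ j ∈ univ, s j ≠ 0 := Finset.exists_ne_zero_of_sum_ne_zero (by omega)
    obtain ⟨r, rfl⟩ : ∃ r, s = r + Pi.single j 1 := by
      refine ⟨s - Pi.single j 1, (tsub_add_cancel_of_le ?_).symm⟩
      intro l
      by_cases hl : l = j
      · subst hl
        simpa using Nat.one_le_iff_ne_zero.mpr hj
      · simp [Pi.single_eq_of_ne hl]
    have hr : ∑ l, r l = k := by
      simpa [sum_add_distrib] using hk
    have hstep := hdr x (x + r) (by simp) j
    have hsum : ∑ l, (((r + Pi.single j 1 : Fin q → ℕ) l : ℕ) : ℝ) * (f (x + Pi.single l 1) - f x) =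
        ∑ l, (r l : ℝ) * (f (x + Pi.single l 1) - f x) + (f (x + Pi.single j 1) - f x) := by
      simp [add_mul, sum_add_distrib, Pi.single_apply]
    have := ih r hr
    rw [← add_assoc, hsum]
    linarith

/-- Every decomposition of a sequence `σ` has welfare at most that of `T` plus the greedy
gains at `T` of the items of `σ`. -/
theorem welfare_le_add_sum_greedy_gain {n q m : ℕ} [NeZero n] (w : Fin n → (Fin q → ℕ) → ℝ)
    (hmono : ∀ (i : Fin n) (x y : Fin q → ℕ), x ≤ y → w i x ≤ w i y)
    (hdr : ∀ (i : Fin n) (x y : Fin q → ℕ), x ≤ y → ∀ j : Fin q,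
      w i (y + Pi.single j 1) - w i y ≤ w i (x + Pi.single j 1) - w i x)
    (T S : Fin n → Fin q → ℕ) (σ : Fin m → Fin q)
    (hS : ∀ j : Fin q, ∑ i : Fin n, S i j = (univ.filter fun t => σ t = j).card) :
    ∑ i, w i (S i) ≤ ∑ i, w i (T i) +
      ∑ t, (∑ i, w i (greedyUpdate w T (σ t) i) - ∑ i, w i (T i)) := by
  set g : Fin q → ℝ := fun j => ∑ i, w i (greedyUpdate w T j i) - ∑ i, w i (T i) with hg
  have hbound (i : Fin n) : w i (S i) ≤ w i (T i) + ∑ j, (S i j : ℝ) * g j := by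
    refine (hmono i (S i) (T i + S i) le_add_self).trans
      ((le_add_sum_marginal (w i) (hdr i) (T i) (S i)).trans ?_)
    gcongr with j
    rw [hg]
    simp only [welfare_greedyUpdate_sub]
    exact marginal_le_marginal_greedyStep w T j i
  have hcount : ∑ i, ∑ j, (S i j : ℝ) * g j = ∑ t, g (σ t) := by
    rw [sum_comm, ← Finset.sum_fiberwise univ σ]
    refine Finset.sum_congr rfl fun j _ => ?_
    rw [← Finset.sum_mul, ← Nat.cast_sum, hS j,
      Finset.sum_congr rfl fun t ht => by rw [(mem_filter.mp ht).2], sum_const, nsmul_eq_mul]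
  calc ∑ i, w i (S i) ≤ ∑ i, (w i (T i) + ∑ j, (S i j : ℝ) * g j) :=
        sum_le_sum fun i _ => hbound i
    _ = _ := by rw [sum_add_distrib, hcount]

/-- Expectation over `k + 1` independent samples, conditioning on the first one. -/
theorem sum_prod_mul_succ {q k : ℕ} (p : Fin q → ℝ) (F : (Fin (k + 1) → Fin q) → ℝ) :
    ∑ σ : Fin (k + 1) → Fin q, (∏ t, p (σ t)) * F σ =
      ∑ j, p j * ∑ σ : Fin k → Fin q, (∏ t, p (σ t)) * F (Fin.cons j σ) := by
  rw [← (Fin.consEquiv fun _ => Fin q).sum_comp, Fintype.sum_prod_type]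
  simp [Fin.consEquiv, Fin.prod_univ_succ, Finset.mul_sum, mul_assoc]

theorem sum_prod_eq_one {q : ℕ} (k : ℕ) (p : Fin q → ℝ) (hp1 : ∑ j, p j = 1) :
    ∑ σ : Fin k → Fin q, ∏ t, p (σ t) = 1 := by
  simpa [hp1] using (Finset.sum_prod_piFinset (ι := Fin k) univ fun _ j => p j)

/-- The expected sum of `g` over `k` independent samples is `k` times its expectation. -/
theorem sum_prod_mul_sum {q : ℕ} (k : ℕ) (p g : Fin q → ℝ) (hp1 : ∑ j, p j = 1) :
    ∑ σ : Fin k → Fin q, (∏ t, p (σ t)) * ∑ t, g (σ t) = k * ∑ j, p j * g j := by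
  induction k with
  | zero => simp
  | succ k ih =>
    rw [sum_prod_mul_succ]
    simp only [Fin.sum_univ_succ, Fin.cons_zero, Fin.cons_succ, mul_add, sum_add_distrib, ih,
      ← Finset.sum_mul, sum_prod_eq_one k p hp1, hp1, one_mul]
    push_cast
    ring

/-- If from every allocation one greedy step shrinks the expected deficit with respect to `B`
by a factor `c`, then `k` greedy steps shrink it by a factor `c ^ k`. -/
theorem expected_deficit_le {n q : ℕ} [NeZero n] (w : Fin n → (Fin q → ℕ) → ℝ)
    (p : Fin q → ℝ) (hp : ∀ j, 0 ≤ p j) (hp1 : ∑ j, p j = 1) {B c : ℝ} (hc : 0 ≤ c)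
    (hstep : ∀ T, B - ∑ j, p j * ∑ i, w i (greedyUpdate w T j i) ≤ c * (B - ∑ i, w i (T i)))
    (k : ℕ) (T : Fin n → Fin q → ℕ) :
    B - ∑ σ : Fin k → Fin q, (∏ t, p (σ t)) *
        ∑ i, w i ((List.ofFn σ).foldl (greedyUpdate w) T i) ≤
      c ^ k * (B - ∑ i, w i (T i)) := by
  induction k generalizing T with
  | zero => simp
  | succ k ih =>
    have hB (F : Fin q → ℝ) : B - ∑ j, p j * F j = ∑ j, p j * (B - F j) := by
      simp [mul_sub, ← Finset.sum_mul, hp1]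
    rw [sum_prod_mul_succ, hB]
    simp only [List.ofFn_succ, Fin.cons_zero, Fin.cons_succ, List.foldl_cons]
    calc _ ≤ ∑ j, p j * (c ^ k * (B - ∑ i, w i (greedyUpdate w T j i))) :=
          sum_le_sum fun j _ => mul_le_mul_of_nonneg_left (ih _) (hp j)
      _ = c ^ k * (B - ∑ j, p j * ∑ i, w i (greedyUpdate w T j i)) := by
          rw [hB, Finset.mul_sum]
          exact Finset.sum_congr rfl fun j _ => mul_left_comm _ _ _
      _ ≤ c ^ k * (c * (B - ∑ i, w i (T i))) :=
          mul_le_mul_of_nonneg_left (hstep T) (pow_nonneg hc k)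
      _ = _ := by ring

/-- Theorem 4.2: in the stochastic i.i.d. model with `m` items drawn independently from a
distribution `p` over `q` item types, for `n ≥ 1` agents with nonnegative monotone
valuations satisfying diminishing returns, the greedy algorithm is `(1 − 1/e)`-competitive
against the expected offline optimum `E[OPT(σ)]`, where `OPT σ` is the best welfare of a
decomposition of the count vector of `σ` among the agents. -/
theorem greedy_iid_competitive (n q m : ℕ) [NeZero n] (hm : 1 ≤ m)
    (w : Fin n → (Fin q → ℕ) → ℝ)
    (hw0 : ∀ (i : Fin n) (x : Fin q → ℕ), 0 ≤ w i x)
    (hmono : ∀ (i : Fin n) (x y : Fin q → ℕ), x ≤ y → w i x ≤ w i y)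
    (hdr : ∀ (i : Fin n) (x y : Fin q → ℕ), x ≤ y → ∀ j : Fin q,
      w i (y + Pi.single j 1) - w i y ≤ w i (x + Pi.single j 1) - w i x)
    (p : Fin q → ℝ) (hp : ∀ j, 0 ≤ p j) (hp1 : ∑ j, p j = 1)
    (OPT : (Fin m → Fin q) → ℝ)
    (hOPT : ∀ σ : Fin m → Fin q, OPT σ = sSup {v : ℝ | ∃ S : Fin n → Fin q → ℕ,
      (∀ j : Fin q, ∑ i : Fin n, S i j = (Finset.univ.filter fun t => σ t = j).card) ∧
      v = ∑ i : Fin n, w i (S i)}) :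
    (1 - 1 / Real.exp 1) * (∑ σ : Fin m → Fin q, (∏ t, p (σ t)) * OPT σ) ≤
      ∑ σ : Fin m → Fin q,
        (∏ t, p (σ t)) * (∑ i : Fin n, w i (greedyAlloc w (List.ofFn σ) i)) := by
  have hprod (σ : Fin m → Fin q) : 0 ≤ ∏ t, p (σ t) := prod_nonneg fun t _ => hp (σ t)
  have hm0 : (0 : ℝ) < m := by exact_mod_cast hm
  set B := ∑ σ : Fin m → Fin q, (∏ t, p (σ t)) * OPT σ with hBdef
  have hOPT0 (σ : Fin m → Fin q) : 0 ≤ OPT σ := by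
    rw [hOPT σ]
    refine Real.sSup_nonneg ?_
    rintro v ⟨S, -, rfl⟩
    exact sum_nonneg fun i _ => hw0 i _
  have hB0 : 0 ≤ B := sum_nonneg fun σ _ => mul_nonneg (hprod σ) (hOPT0 σ)
  have hOPTle (T : Fin n → Fin q → ℕ) (σ : Fin m → Fin q) : OPT σ ≤ ∑ i, w i (T i) +
      ∑ t, (∑ i, w i (greedyUpdate w T (σ t) i) - ∑ i, w i (T i)) := by
    rw [hOPT σ]
    refine csSup_le ?_ ?_
    · refine ⟨_, fun i j => if i = 0 then (univ.filter fun t => σ t = j).card else 0, ?_, rfl⟩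
      intro j
      simp
    · rintro v ⟨S, hS, rfl⟩
      exact welfare_le_add_sum_greedy_gain w hmono hdr T S σ hS
  have hstep (T : Fin n → Fin q → ℕ) : B - ∑ j, p j * ∑ i, w i (greedyUpdate w T j i) ≤
      (1 - 1 / (m : ℝ)) * (B - ∑ i, w i (T i)) := by
    have h : B ≤ ∑ i, w i (T i) +
        m * (∑ j, p j * ∑ i, w i (greedyUpdate w T j i) - ∑ i, w i (T i)) := by
      calc B ≤ ∑ σ : Fin m → Fin q, (∏ t, p (σ t)) * (∑ i, w i (T i) +
            ∑ t, (∑ i, w i (greedyUpdate w T (σ t) i) - ∑ i, w i (T i))) :=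
            sum_le_sum fun σ _ => mul_le_mul_of_nonneg_left (hOPTle T σ) (hprod σ)
        _ = _ := by
            simp only [mul_add, sum_add_distrib]
            rw [← Finset.sum_mul, sum_prod_eq_one m p hp1, one_mul,
              sum_prod_mul_sum m p
                (fun j => ∑ i, w i (greedyUpdate w T j i) - ∑ i, w i (T i)) hp1]
            simp only [mul_sub, sum_sub_distrib]
            rw [← Finset.sum_mul, hp1, one_mul]
    have h' : (B - ∑ i, w i (T i)) / m ≤
        ∑ j, p j * ∑ i, w i (greedyUpdate w T j i) - ∑ i, w i (T i) := by
      rw [div_le_iff₀ hm0]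
      linarith
    have : (1 - 1 / (m : ℝ)) * (B - ∑ i, w i (T i)) =
        (B - ∑ i, w i (T i)) - (B - ∑ i, w i (T i)) / m := by ring
    linarith
  have hc : 0 ≤ 1 - 1 / (m : ℝ) := by
    rw [sub_nonneg, div_le_one hm0]
    exact_mod_cast hm
  have hpow : (1 - 1 / (m : ℝ)) ^ m ≤ 1 / Real.exp 1 := by
    rw [one_div (Real.exp 1), ← Real.exp_neg]
    exact Real.one_sub_div_pow_le_exp_neg (by exact_mod_cast hm)
  have hdef := expected_deficit_le w p hp hp1 hc hstep m fun _ _ => 0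
  have hW0 : 0 ≤ ∑ i, w i fun _ => 0 := sum_nonneg fun i _ => hw0 i _
  have hfinal : (1 - 1 / (m : ℝ)) ^ m * (B - ∑ i, w i fun _ => 0) ≤ 1 / Real.exp 1 * B :=
    (mul_le_mul_of_nonneg_left (sub_le_self B hW0) (pow_nonneg hc m)).trans
      (mul_le_mul_of_nonneg_right hpow hB0)
  have hgreedy : ∀ l, greedyAlloc w l = l.foldl (greedyUpdate w) fun _ _ => 0 := fun _ => rfl
  simp only [hgreedy]
  linarith
end
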